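/- Let 0 < q < 1, let k be a positive integer, let s > 0, and let A ∈ ℝ^{n×p} with spectral norm σ(A). Let x ∈ ℝ^p be arbitrary, z ∈ ℝ^n with ‖z‖_2 ≤ ε, and y = Ax + z. Let η ≥ ε + σ(A)·‖x_{-max(k)}‖_2, and let x̂ be a minimizer of ‖w‖_q^q subject to ‖y - Aw‖_2 ≤ η. If the ⌈(s^q+1)k⌉-order restricted isometry constant δ = δ_{(s^q+1)k} of A satisfies δ < 1/√(s^{q-2}+1), then ‖x̂ - x‖_2 ≤ √(2(1+δ))·(ε+η)/(1 - √(s^{q-2}+1)·δ) + ( √(2(1+δ))·σ(A)/(1 - √(s^{q-2}+1)·δ) + 1 )·‖x_{-max(k)}‖_2. -/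

import Mathlib

open scoped BigOperators

/-- `‖v‖_q^q = ∑ |v i|^q` for `v ∈ ℝ^p`. -/
noncomputable def lqq (q : ℝ) {p : ℕ} (v : Fin p → ℝ) : ℝ := ∑ i, |v i| ^ q

/-- The `ℓ_q` quasinorm `(∑ |v i|^q)^(1/q)`. -/
noncomputable def lqNorm (q : ℝ) {p : ℕ} (v : Fin p → ℝ) : ℝ := (∑ i, |v i| ^ q) ^ (1/q)

/-- Euclidean norm on `ℝ^p`. -/
noncomputable def l2Norm {p : ℕ} (v : Fin p → ℝ) : ℝ := Real.sqrt (∑ i, (v i) ^ 2)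

/-- `ℓ_1` norm on `ℝ^p`. -/
noncomputable def l1Norm {p : ℕ} (v : Fin p → ℝ) : ℝ := ∑ i, |v i|

/-- `ℓ_∞` norm on `ℝ^p`. -/
noncomputable def linfNorm {p : ℕ} (v : Fin p → ℝ) : ℝ := ⨆ i, |v i|

open Classical in
/-- `‖v‖_0`: number of nonzero entries of `v`. -/
noncomputable def l0 {p : ℕ} (v : Fin p → ℝ) : ℕ := (Finset.univ.filter (fun i => v i ≠ 0)).card

/-- `v` is `k`-sparse if it has at most `k` nonzero entries. -/
def Sparse {p : ℕ} (k : ℕ) (v : Fin p → ℝ) : Prop := l0 v ≤ k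

/-- The `m`-order restricted isometry constant of `A`: the infimum of those `δ ≥ 0` such
that `(1-δ)‖x‖₂² ≤ ‖Ax‖₂² ≤ (1+δ)‖x‖₂²` for all `m`-sparse `x`. -/
noncomputable def ric {n p : ℕ} (A : Matrix (Fin n) (Fin p) ℝ) (m : ℕ) : ℝ :=
  sInf {δ : ℝ | 0 ≤ δ ∧ ∀ x : Fin p → ℝ, Sparse m x →
    (1 - δ) * (∑ i, (x i) ^ 2) ≤ (∑ i, (A.mulVec x i) ^ 2) ∧
    (∑ i, (A.mulVec x i) ^ 2) ≤ (1 + δ) * (∑ i, (x i) ^ 2)}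

/-- The spectral norm of `A`: the least `c ≥ 0` with `‖Av‖₂ ≤ c‖v‖₂` for all `v`. -/
noncomputable def specNorm {n p : ℕ} (A : Matrix (Fin n) (Fin p) ℝ) : ℝ :=
  sInf {c : ℝ | 0 ≤ c ∧ ∀ v : Fin p → ℝ, l2Norm (A.mulVec v) ≤ c * l2Norm v}

/-- `vk` is a version of `v` with all but the `k` largest-magnitude entries set to zero. -/
def IsMaxK {p : ℕ} (k : ℕ) (v vk : Fin p → ℝ) : Prop :=
  ∃ T : Finset (Fin p), T.card = min k p ∧
    (∀ i ∈ T, ∀ j ∉ T, |v j| ≤ |v i|) ∧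
    vk = fun i => if i ∈ T then v i else 0

section helpers

lemma aux_l2_eq {p : ℕ} (v : Fin p → ℝ) : l2Norm v = ‖(WithLp.toLp 2 v : EuclideanSpace ℝ (Fin p))‖ := by
  rw [EuclideanSpace.norm_eq]; simp [l2Norm]

lemma aux_tri {p : ℕ} (u v : Fin p → ℝ) : l2Norm (u + v) ≤ l2Norm u + l2Norm v := by
  rw [aux_l2_eq, aux_l2_eq, aux_l2_eq, WithLp.toLp_add]; exact norm_add_le _ _

lemma aux_neg {p : ℕ} (u : Fin p → ℝ) : l2Norm (-u) = l2Norm u := by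
  simp [l2Norm]

lemma aux_nonneg {p : ℕ} (u : Fin p → ℝ) : 0 ≤ l2Norm u := Real.sqrt_nonneg _

lemma aux_sq {p : ℕ} (u : Fin p → ℝ) : l2Norm u ^ 2 = ∑ i, u i ^ 2 :=
  Real.sq_sqrt (Finset.sum_nonneg fun i _ => sq_nonneg _)

lemma aux_sInf (S : Set ℝ) (hS : S.Nonempty) (b X : ℝ) (hX : 0 ≤ X) (h : ∀ c ∈ S, b ≤ c * X) :
    b ≤ sInf S * X := by
  rcases hX.eq_or_lt with h0 | h0
  · obtain ⟨c, hc⟩ := hS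
    have := h c hc
    rw [← h0] at this ⊢; simpa using this
  · rw [← div_le_iff₀ h0]
    exact le_csInf hS fun c hc => (div_le_iff₀ h0).2 (h c hc)

lemma aux_bdd {n p : ℕ} (A : Matrix (Fin n) (Fin p) ℝ) :
    ∃ c : ℝ, 0 ≤ c ∧ ∀ v : Fin p → ℝ, l2Norm (A.mulVec v) ≤ c * l2Norm v := by
  refine ⟨‖LinearMap.toContinuousLinearMap (Matrix.toEuclideanLin A)‖, norm_nonneg _, fun v => ?_⟩
  rw [aux_l2_eq, aux_l2_eq]
  exact (LinearMap.toContinuousLinearMap (Matrix.toEuclideanLin A)).le_opNorm (WithLp.toLp 2 v)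

lemma aux_spec {n p : ℕ} (A : Matrix (Fin n) (Fin p) ℝ) (v : Fin p → ℝ) :
    l2Norm (A.mulVec v) ≤ specNorm A * l2Norm v :=
  aux_sInf _ (aux_bdd A) _ _ (aux_nonneg v) fun _ hc => hc.2 v

lemma aux_ric_nonneg {n p : ℕ} (A : Matrix (Fin n) (Fin p) ℝ) (m : ℕ) : 0 ≤ ric A m :=
  Real.sInf_nonneg fun _ hc => hc.1

lemma aux_ric {n p : ℕ} (A : Matrix (Fin n) (Fin p) ℝ) (m : ℕ) (x : Fin p → ℝ) (hx : Sparse m x) :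
    (1 - ric A m) * (∑ i, (x i) ^ 2) ≤ (∑ i, (A.mulVec x i) ^ 2) ∧
    (∑ i, (A.mulVec x i) ^ 2) ≤ (1 + ric A m) * (∑ i, (x i) ^ 2) := by
  have hne : {δ : ℝ | 0 ≤ δ ∧ ∀ x : Fin p → ℝ, Sparse m x →
    (1 - δ) * (∑ i, (x i) ^ 2) ≤ (∑ i, (A.mulVec x i) ^ 2) ∧
    (∑ i, (A.mulVec x i) ^ 2) ≤ (1 + δ) * (∑ i, (x i) ^ 2)}.Nonempty := by
    obtain ⟨c, hc, h⟩ := aux_bdd A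
    refine ⟨1 + c ^ 2, by positivity, fun x _ => ?_⟩
    rw [← aux_sq, ← aux_sq]
    have h1 := pow_le_pow_left₀ (aux_nonneg _) (h x) 2
    rw [mul_pow] at h1
    have h2 := sq_nonneg (l2Norm x)
    have h3 := sq_nonneg (l2Norm (A.mulVec x))
    have h4 := mul_nonneg (sq_nonneg c) h2
    constructor <;> nlinarith
  have hX : 0 ≤ ∑ i, (x i) ^ 2 := Finset.sum_nonneg fun i _ => sq_nonneg _
  have h1 := aux_sInf _ hne ((∑ i, (x i) ^ 2) - ∑ i, (A.mulVec x i) ^ 2) _ hX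
    (fun c hc => by have := (hc.2 x hx).1; linarith)
  have h2 := aux_sInf _ hne ((∑ i, (A.mulVec x i) ^ 2) - ∑ i, (x i) ^ 2) _ hX
    (fun c hc => by have := (hc.2 x hx).2; linarith)
  change _ ≤ ric A m * _ at h1
  change _ ≤ ric A m * _ at h2
  constructor <;> linarith

open Classical in
lemma aux_sparse_pt {p : ℕ} (c : Fin p → ℝ) (β L : ℝ) (d : ℕ) (hβ : 0 < β) (hL : L ≤ d * β) :
    ∀ (N : ℕ) (v : Fin p → ℝ), (∀ i, 0 ≤ v i ∧ v i ≤ β) → ∑ i, v i ≤ L →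
      (Finset.univ.filter (fun i => 0 < v i ∧ v i < β)).card ≤ N →
      ∃ u : Fin p → ℝ, (∀ i, 0 ≤ u i ∧ u i ≤ β) ∧ (∀ i, v i = 0 → u i = 0) ∧ ∑ i, u i ≤ L ∧
        ∑ i, c i * u i ≤ ∑ i, c i * v i ∧ (Finset.univ.filter (fun i => u i ≠ 0)).card ≤ d := by
  intro N
  induction N with
  | zero | succ N ih =>
    intro v hv hs hN
    by_cases hF : (Finset.univ.filter (fun i => 0 < v i ∧ v i < β)).card ≤ 1
    · refine ⟨v, hv, fun _ h => h, hs, le_rfl, ?_⟩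
      set S := Finset.univ.filter (fun i => v i ≠ 0) with hS
      set F := Finset.univ.filter (fun i => 0 < v i ∧ v i < β) with hFd
      have e1 : ∑ i ∈ S, v i = ∑ i, v i := by
        apply Finset.sum_subset (Finset.subset_univ _)
        intro i _ hi; simpa [hS] using hi
      have hsub : F ⊆ S := by
        intro i hi
        simp only [hFd, hS, Finset.mem_filter, Finset.mem_univ, true_and] at hi ⊢
        exact hi.1.ne'
      have e2 : ∑ i ∈ F, (β - v i) = ∑ i ∈ S, (β - v i) := by
        apply Finset.sum_subset hsub
        intro i hi hi'
        simp only [hFd, hS, Finset.mem_filter, Finset.mem_univ, true_and] at hi hi'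
        have h1 := hv i
        have h2 : 0 < v i := lt_of_le_of_ne h1.1 (Ne.symm hi)
        have : ¬ v i < β := fun h => hi' ⟨h2, h⟩
        linarith
      have e3 : ∑ i ∈ F, (β - v i) < β := by
        by_cases hE : F = ∅
        · rw [hE]; simpa using hβ
        · obtain ⟨i, hi⟩ := Finset.nonempty_iff_ne_empty.2 hE
          have : F = {i} := by
            apply Finset.eq_singleton_iff_unique_mem.2
            exact ⟨hi, fun j hj => Finset.card_le_one.1 hF j hj i hi⟩
          rw [this, Finset.sum_singleton]
          have := (Finset.mem_filter.1 hi).2.1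
          linarith
      rw [e2, Finset.sum_sub_distrib, e1, Finset.sum_const, nsmul_eq_mul] at e3
      have : (S.card : ℝ) * β < (d + 1) * β := by linarith
      have := lt_of_mul_lt_mul_right this hβ.le
      have h5 : S.card < d + 1 := by exact_mod_cast this
      omega
    · first
      | (exfalso; omega)
      | (push Not at hF
         obtain ⟨i0, hi0, j0, hj0, hij0⟩ := Finset.one_lt_card.1 hF
         obtain ⟨i, j, hij, hi, hj, hc⟩ : ∃ i j, i ≠ j ∧ (0 < v i ∧ v i < β) ∧ (0 < v j ∧ v j < β) ∧
            c i ≤ c j := by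
           have hi0 := (Finset.mem_filter.1 hi0).2
           have hj0 := (Finset.mem_filter.1 hj0).2
           rcases le_total (c i0) (c j0) with h | h
           · exact ⟨i0, j0, hij0, hi0, hj0, h⟩
           · exact ⟨j0, i0, hij0.symm, hj0, hi0, h⟩
         set t := min (β - v i) (v j) with ht
         have ht1 : t ≤ β - v i := min_le_left _ _
         have ht2 : t ≤ v j := min_le_right _ _
         have ht0 : 0 < t := lt_min (by linarith) hj.1
         have ht3 : t = β - v i ∨ t = v j := min_choice _ _
         set w : Fin p → ℝ := v + Pi.single i t - Pi.single j t with hw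
         have wi : w i = v i + t := by simp [hw, hij]
         have wj : w j = v j - t := by simp [hw, hij.symm]
         have wo : ∀ l, l ≠ i → l ≠ j → w l = v l := fun l h1 h2 => by simp [hw, h1, h2]
         have wsum : ∀ f : Fin p → ℝ, ∑ l, f l * w l = ∑ l, f l * v l + f i * t - f j * t := by
           intro f
           simp [hw, mul_add, mul_sub, Finset.sum_add_distrib, Finset.sum_sub_distrib, Pi.single_apply]
         have hwb : ∀ l, 0 ≤ w l ∧ w l ≤ β := by
           intro l
           by_cases h1 : l = i
           · subst h1; rw [wi]; constructor <;> linarith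
           · by_cases h2 : l = j
             · subst h2; rw [wj]; constructor <;> linarith
             · rw [wo l h1 h2]; exact hv l
         have hws : ∑ l, w l ≤ L := by
           have := wsum (fun _ => 1)
           simp only [one_mul] at this
           linarith
         have hlt : (Finset.univ.filter (fun l => 0 < w l ∧ w l < β)).card <
             (Finset.univ.filter (fun l => 0 < v l ∧ v l < β)).card := by
           apply Finset.card_lt_card
           rw [Finset.ssubset_iff_of_subset]
           · rcases ht3 with h | h
             · refine ⟨i, by simpa using hi, ?_⟩
               simp only [Finset.mem_filter, Finset.mem_univ, true_and, wi]
               rintro ⟨_, h'⟩; linarith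
             · refine ⟨j, by simpa using hj, ?_⟩
               simp only [Finset.mem_filter, Finset.mem_univ, true_and, wj]
               rintro ⟨h', _⟩; linarith
           · intro l hl
             simp only [Finset.mem_filter, Finset.mem_univ, true_and] at hl ⊢
             by_cases h1 : l = i
             · subst h1; exact hi
             · by_cases h2 : l = j
               · subst h2; exact hj
               · rwa [wo l h1 h2] at hl
         obtain ⟨u, hu1, hu2, hu3, hu4, hu5⟩ := ih w hwb hws (by omega)
         refine ⟨u, hu1, fun l hl => ?_, hu3, ?_, hu5⟩
         · apply hu2
           rw [wo l, hl]
           · rintro rfl; linarith [hi.1]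
           · rintro rfl; linarith [hj.1]
         · have := wsum c
           have := mul_le_mul_of_nonneg_right hc ht0.le
           linarith)

lemma aux_top {p : ℕ} (f : Fin p → ℝ) : ∀ m : ℕ, m ≤ p →
    ∃ T : Finset (Fin p), T.card = m ∧ ∀ i ∈ T, ∀ j ∉ T, f j ≤ f i := by
  intro m
  induction m with
  | zero => intro _; exact ⟨∅, by simp, by simp⟩
  | succ m ih =>
    intro hm
    obtain ⟨T, hT, h⟩ := ih (by omega)
    have hne : (Tᶜ).Nonempty := by
      rw [← Finset.card_pos, Finset.card_compl, Fintype.card_fin]; omega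
    obtain ⟨l, hl, hmax⟩ := Finset.exists_max_image Tᶜ f hne
    rw [Finset.mem_compl] at hl
    refine ⟨insert l T, by rw [Finset.card_insert_of_notMem hl, hT], ?_⟩
    intro i hi j hj
    rw [Finset.mem_insert, not_or] at hj
    rcases Finset.mem_insert.1 hi with rfl | hi
    · exact hmax j (by simpa using hj.2)
    · exact h i hi j hj.2

lemma aux_thresh {p k : ℕ} (hk : 0 < k) (f : Fin p → ℝ) (hf : ∀ i, 0 ≤ f i) :
    ∃ T : Finset (Fin p), T.card = min k p ∧ ∃ M : ℝ, 0 ≤ M ∧ (∀ i ∈ T, M ≤ f i) ∧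
      ∀ j ∉ T, f j ≤ M := by
  obtain ⟨T, hT, h⟩ := aux_top f (min k p) (min_le_right _ _)
  refine ⟨T, hT, ?_⟩
  by_cases hne : T.Nonempty
  · obtain ⟨l, hl, hmin⟩ := Finset.exists_min_image T f hne
    exact ⟨f l, hf l, hmin, fun j hj => h l hl j hj⟩
  · have : p = 0 := by
      rw [Finset.not_nonempty_iff_eq_empty.1 hne] at hT
      simp at hT; omega
    subst this
    exact ⟨0, le_rfl, fun i => i.elim0, fun i => i.elim0⟩

lemma aux_sum_dom {p : ℕ} (g : Fin p → ℝ) (S T : Finset (Fin p)) (hc : S.card = T.card) (M : ℝ)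
    (h1 : ∀ i ∈ T, M ≤ g i) (h2 : ∀ j ∉ T, g j ≤ M) : ∑ i ∈ S, g i ≤ ∑ i ∈ T, g i := by
  rw [← Finset.sum_inter_add_sum_sdiff S T g, ← Finset.sum_inter_add_sum_sdiff T S g,
    Finset.inter_comm T S]
  have hcard : (S \ T).card = (T \ S).card := by
    have a1 := Finset.card_sdiff_add_card_inter S T
    have a2 := Finset.card_sdiff_add_card_inter T S
    rw [Finset.inter_comm T S] at a2
    omega
  have b1 : ∑ i ∈ S \ T, g i ≤ (S \ T).card • M :=
    Finset.sum_le_card_nsmul _ _ _ fun i hi => h2 i (Finset.mem_sdiff.1 hi).2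
  have b2 : (T \ S).card • M ≤ ∑ i ∈ T \ S, g i :=
    Finset.card_nsmul_le_sum _ _ _ fun i hi => h1 i (Finset.mem_sdiff.1 hi).1
  rw [hcard] at b1
  linarith

lemma aux_power_mean {p k : ℕ} (q : ℝ) (hq0 : 0 < q) (hq1 : q < 1) (h : Fin p → ℝ)
    (T : Finset (Fin p)) (hT : T.card ≤ k) (α : ℝ) (hα : 0 < α)
    (hV : ∑ i ∈ T, |h i| ^ q = k * α ^ q) : k * α ^ 2 ≤ ∑ i ∈ T, h i ^ 2 := by
  have key : ∀ i ∈ T, |h i| ^ q * α ^ (2 - q) ≤ q / 2 * h i ^ 2 + (1 - q / 2) * α ^ 2 := by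
    intro i _
    have := Real.geom_mean_le_arith_mean2_weighted (w₁ := q / 2) (w₂ := 1 - q / 2)
      (p₁ := |h i| ^ 2) (p₂ := α ^ 2) (by linarith) (by linarith) (by positivity) (by positivity)
      (by ring)
    rw [← Real.rpow_natCast, ← Real.rpow_natCast, ← Real.rpow_mul (abs_nonneg _),
      ← Real.rpow_mul hα.le] at this
    rw [← sq_abs (h i)]
    convert this using 3 <;> push_cast <;> ring_nf
    all_goals norm_num
  have h1 := Finset.sum_le_sum key
  rw [← Finset.sum_mul, hV, Finset.sum_add_distrib, ← Finset.mul_sum, Finset.sum_const,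
    nsmul_eq_mul, mul_assoc, ← Real.rpow_add hα] at h1
  have e : α ^ (q + (2 - q)) = α ^ 2 := by
    rw [show q + (2 - q) = ((2 : ℕ) : ℝ) by push_cast; ring, Real.rpow_natCast]
  rw [e] at h1
  have h2 : (T.card : ℝ) * ((1 - q / 2) * α ^ 2) ≤ k * ((1 - q / 2) * α ^ 2) := by
    have : (0 : ℝ) ≤ 1 - q / 2 := by linarith
    gcongr
  have : q / 2 * (k * α ^ 2) ≤ q / 2 * ∑ i ∈ T, h i ^ 2 := by linarith
  exact le_of_mul_le_mul_left this (by linarith)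

lemma aux_cone {p : ℕ} (q : ℝ) (hq0 : 0 < q) (hq1 : q < 1) (xk xhat : Fin p → ℝ)
    (S : Finset (Fin p)) (hS : ∀ i ∉ S, xk i = 0) (hle : lqq q xhat ≤ lqq q xk) :
    ∑ i, |(xhat - xk) i| ^ q ≤ 2 * ∑ i ∈ S, |(xhat - xk) i| ^ q := by
  unfold lqq at hle
  rw [← Finset.sum_add_sum_compl S] at hle ⊢
  rw [← Finset.sum_add_sum_compl S (fun i => |xk i| ^ q)] at hle
  have e1 : ∑ i ∈ Sᶜ, |xk i| ^ q = 0 := Finset.sum_eq_zero fun i hi => by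
    rw [hS i (Finset.mem_compl.1 hi), abs_zero, Real.zero_rpow hq0.ne']
  have e2 : ∑ i ∈ Sᶜ, |(xhat - xk) i| ^ q = ∑ i ∈ Sᶜ, |xhat i| ^ q :=
    Finset.sum_congr rfl fun i hi => by
      rw [Pi.sub_apply, hS i (Finset.mem_compl.1 hi), sub_zero]
  have e3 : ∑ i ∈ S, |xk i| ^ q ≤ ∑ i ∈ S, (|xhat i| ^ q + |(xhat - xk) i| ^ q) := by
    apply Finset.sum_le_sum
    intro i _
    refine le_trans ?_ (Real.rpow_add_le_add_rpow (abs_nonneg _) (abs_nonneg _) hq0.le hq1.le)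
    apply Real.rpow_le_rpow (abs_nonneg _) _ hq0.le
    have := abs_sub_abs_le_abs_sub (xk i) (xhat i)
    rw [abs_sub_comm] at this
    simp only [Pi.sub_apply]; linarith
  rw [Finset.sum_add_distrib] at e3
  linarith

lemma aux_tail {p : ℕ} (q : ℝ) (hq0 : 0 < q) (hq1 : q < 1) (h : Fin p → ℝ)
    (T : Finset (Fin p)) (M : ℝ) (hM : 0 ≤ M) (h1 : ∀ i ∈ T, M ≤ |h i|) (h2 : ∀ j ∉ T, |h j| ≤ M)
    (hc : ∑ i ∈ Tᶜ, |h i| ^ q ≤ ∑ i ∈ T, |h i| ^ q) :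
    ∑ i ∈ Tᶜ, h i ^ 2 ≤ ∑ i ∈ T, h i ^ 2 := by
  have e : ∀ i, h i ^ 2 = |h i| ^ (2 - q) * |h i| ^ q := by
    intro i
    rw [← Real.rpow_add' (abs_nonneg _) (by norm_num), show 2 - q + q = ((2 : ℕ) : ℝ) by push_cast; ring,
      Real.rpow_natCast, sq_abs]
  calc ∑ i ∈ Tᶜ, h i ^ 2 ≤ ∑ i ∈ Tᶜ, M ^ (2 - q) * |h i| ^ q := by
        apply Finset.sum_le_sum; intro i hi
        rw [e]
        have := Real.rpow_le_rpow (abs_nonneg _) (h2 i (Finset.mem_compl.1 hi)) (by linarith : 0 ≤ 2 - q)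
        gcongr
    _ ≤ ∑ i ∈ T, M ^ (2 - q) * |h i| ^ q := by
        rw [← Finset.mul_sum, ← Finset.mul_sum]
        gcongr
    _ ≤ ∑ i ∈ T, h i ^ 2 := by
        apply Finset.sum_le_sum; intro i hi
        rw [e]
        have := Real.rpow_le_rpow hM (h1 i hi) (by linarith : 0 ≤ 2 - q)
        gcongr

open Classical in
lemma aux_sparse_of {p m : ℕ} (v : Fin p → ℝ) (S : Finset (Fin p)) (hS : ∀ i ∉ S, v i = 0)
    (hm : S.card ≤ m) : Sparse m v := by
  unfold Sparse l0
  refine le_trans (Finset.card_le_card ?_) hm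
  intro i hi
  by_contra h
  exact (Finset.mem_filter.1 hi).2 (hS i h)

/-- the algebraic core -/
lemma aux_alg {n p : ℕ} (A : Matrix (Fin n) (Fin p) ℝ) (a u h : Fin p → ℝ) (δ w : ℝ)
    (hδ : 0 ≤ δ) (hw : 0 < w)
    (hau : ∀ i, a i * u i = 0)
    (hrip : ∀ b c : ℝ, 
      (1 - δ) * (∑ i, ((b • a + c • u) i) ^ 2) ≤ (∑ i, (A.mulVec (b • a + c • u) i) ^ 2) ∧
      (∑ i, (A.mulVec (b • a + c • u) i) ^ 2) ≤ (1 + δ) * (∑ i, ((b • a + c • u) i) ^ 2))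
    (hU : ∑ i, u i ^ 2 ≤ (w ^ 2 - 1) * ∑ i, a i ^ 2)
    (hK : ∑ i, A.mulVec a i * A.mulVec u i + ∑ i, A.mulVec a i ^ 2 ≤
      ∑ i, A.mulVec a i * A.mulVec h i) :
    (1 - w * δ) * l2Norm a ≤ Real.sqrt (1 + δ) * l2Norm (A.mulVec h) := by
  have e1 : ∀ b c : ℝ, ∑ i, ((b • a + c • u) i) ^ 2 = b ^ 2 * ∑ i, a i ^ 2 + c ^ 2 * ∑ i, u i ^ 2 := by
    intro b c
    rw [Finset.mul_sum, Finset.mul_sum, ← Finset.sum_add_distrib]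
    apply Finset.sum_congr rfl; intro i _
    simp only [Pi.add_apply, Pi.smul_apply, smul_eq_mul]
    linear_combination 2 * b * c * hau i
  have e2 : ∀ b c : ℝ, ∑ i, (A.mulVec (b • a + c • u) i) ^ 2 = b ^ 2 * ∑ i, A.mulVec a i ^ 2
      + 2 * b * c * ∑ i, A.mulVec a i * A.mulVec u i + c ^ 2 * ∑ i, A.mulVec u i ^ 2 := by
    intro b c
    rw [Finset.mul_sum, Finset.mul_sum, Finset.mul_sum, ← Finset.sum_add_distrib,
      ← Finset.sum_add_distrib]
    apply Finset.sum_congr rfl; intro i _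
    rw [Matrix.mulVec_add, Matrix.mulVec_smul, Matrix.mulVec_smul]
    simp only [Pi.add_apply, Pi.smul_apply, smul_eq_mul]
    ring
  simp only [e1, e2] at hrip
  have r1 := (hrip (1 + w) 1).1
  have r2 := (hrip (w - 1) (-1)).2
  have r3 := (hrip 1 0).2
  have hX := aux_sq a
  have hP := aux_sq (A.mulVec a)
  have hH := aux_sq (A.mulVec h)
  have hCS := Finset.sum_mul_sq_le_sq_mul_sq Finset.univ (A.mulVec a) (A.mulVec h)
  have hKn : ∑ i, A.mulVec a i * A.mulVec h i ≤ l2Norm (A.mulVec a) * l2Norm (A.mulVec h) := by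
    refine (abs_le_of_sq_le_sq' ?_ ?_).2
    · rw [mul_pow, hP, hH]; exact hCS
    · exact mul_nonneg (aux_nonneg _) (aux_nonneg _)
  rw [← hX] at r1 r2 r3 hU
  rw [← hP] at r1 r2 r3 hK
  set X := l2Norm a
  set P := l2Norm (A.mulVec a)
  set H := l2Norm (A.mulVec h)
  set G := ∑ i, A.mulVec a i * A.mulVec u i
  set K := ∑ i, A.mulVec a i * A.mulVec h i
  set U := ∑ i, u i ^ 2
  set R := ∑ i, A.mulVec u i ^ 2
  have X0 : 0 ≤ X := aux_nonneg _
  have H0 : 0 ≤ H := aux_nonneg _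
  have main : (1 - w * δ) * X ^ 2 ≤ K := by
    have h1 : 4 * w * ((1 - w * δ) * X ^ 2) ≤ 4 * w * (P ^ 2 + G) := by
      have := mul_le_mul_of_nonneg_left hU hδ
      linarith
    have h2 := le_of_mul_le_mul_left h1 (by positivity)
    linarith
  have PX : P ≤ Real.sqrt (1 + δ) * X := by
    refine (abs_le_of_sq_le_sq' ?_ ?_).2
    · rw [mul_pow, Real.sq_sqrt (by linarith)]; linarith
    · positivity
  rcases X0.eq_or_lt with h0 | h0
  · rw [← h0]; simp; positivity
  · have : ((1 - w * δ) * X) * X ≤ (Real.sqrt (1 + δ) * H) * X := by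
      have := mul_le_mul_of_nonneg_right PX H0
      linarith
    exact le_of_mul_le_mul_right this h0

open Classical in
lemma aux_core {n p : ℕ} (q : ℝ) (hq0 : 0 < q) (hq1 : q < 1)
    (k : ℕ) (hk : 0 < k) (s : ℝ) (hs : 0 < s)
    (A : Matrix (Fin n) (Fin p) ℝ) (h : Fin p → ℝ) (T : Finset (Fin p)) (hT : T.card ≤ k)
    (hc : ∑ i ∈ Tᶜ, |h i| ^ q ≤ ∑ i ∈ T, |h i| ^ q)
    (ht : ∑ i ∈ Tᶜ, h i ^ 2 ≤ ∑ i ∈ T, h i ^ 2)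
    (δ : ℝ) (hδdef : δ = ric A ⌈(s ^ q + 1) * (k : ℝ)⌉₊)
    (hδ : Real.sqrt (s ^ (q - 2) + 1) * δ < 1) :
    (1 - Real.sqrt (s ^ (q - 2) + 1) * δ) * l2Norm h ≤
      Real.sqrt (2 * (1 + δ)) * l2Norm (A.mulVec h) := by
  have hδ0 : 0 ≤ δ := hδdef ▸ aux_ric_nonneg _ _
  set V := ∑ i ∈ T, |h i| ^ q with hV
  have hV0 : 0 ≤ V := Finset.sum_nonneg fun i _ => by positivity
  have hkR : (0 : ℝ) < k := by exact_mod_cast hk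
  have hsq : ∑ i, h i ^ 2 ≤ 2 * ∑ i ∈ T, h i ^ 2 := by
    rw [← Finset.sum_add_sum_compl T]; linarith
  rcases hV0.eq_or_lt with h0 | hVpos
  · have hz : ∀ i ∈ T, h i ^ 2 = 0 := by
      intro i hi
      have := (Finset.sum_eq_zero_iff_of_nonneg (fun i _ => by positivity)).1 h0.symm i hi
      have := (Real.rpow_eq_zero (abs_nonneg _) hq0.ne').1 this
      rw [abs_eq_zero] at this
      rw [this]; norm_num
    rw [Finset.sum_eq_zero hz] at hsq
    have hl : l2Norm h = 0 := Real.sqrt_eq_zero_of_nonpos (by linarith)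
    rw [hl, mul_zero]
    exact mul_nonneg (Real.sqrt_nonneg _) (aux_nonneg _)
  obtain ⟨α, hα, hαq⟩ : ∃ α : ℝ, 0 < α ∧ α ^ q = V / k := by
    refine ⟨(V / k) ^ (1 / q), by positivity, ?_⟩
    rw [← Real.rpow_mul (by positivity), one_div_mul_cancel hq0.ne', Real.rpow_one]
  have hVα : V = k * α ^ q := by rw [hαq]; field_simp
  have hpm := aux_power_mean q hq0 hq1 h T hT α hα (hV.symm.trans hVα)
  set β := α / s with hβd
  have hβ : 0 < β := by positivity
  have hβq : V = s ^ q * k * β ^ q := by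
    rw [hVα, hβd, Real.div_rpow hα.le hs.le]
    have : s ^ q ≠ 0 := by positivity
    field_simp
  have hβqpos : 0 < β ^ q := by positivity
  set H1 := Tᶜ.filter (fun i => β < |h i|) with hH1
  set H2 := Tᶜ.filter (fun i => ¬ β < |h i|) with hH2
  have hsplit : ∑ i ∈ H1, |h i| ^ q + ∑ i ∈ H2, |h i| ^ q = ∑ i ∈ Tᶜ, |h i| ^ q :=
    Finset.sum_filter_add_sum_filter_not _ _ _
  set r := H1.card with hr
  have hr1 : r * β ^ q ≤ ∑ i ∈ H1, |h i| ^ q := by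
    rw [← nsmul_eq_mul]
    apply Finset.card_nsmul_le_sum
    intro i hi
    exact Real.rpow_le_rpow hβ.le (Finset.mem_filter.1 hi).2.le hq0.le
  have hH2q : ∑ i ∈ H2, |h i| ^ q ≤ (s ^ q * k - r) * β ^ q := by
    rw [sub_mul, ← hβq]; linarith
  have hr2 : (r : ℝ) ≤ s ^ q * k := by
    have : 0 ≤ ∑ i ∈ H2, |h i| ^ q := Finset.sum_nonneg fun i _ => by positivity
    have := nonneg_of_mul_nonneg_left (this.trans hH2q) hβqpos
    linarith
  set N := ⌈(s ^ q + 1) * (k : ℝ)⌉₊ with hN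
  have hN1 : (s ^ q + 1) * (k : ℝ) ≤ N := Nat.le_ceil _
  have hN2 : k + r ≤ N := by
    have : ((k + r : ℕ) : ℝ) ≤ N := by push_cast; linarith
    exact_mod_cast this
  obtain ⟨d, hd⟩ := Nat.exists_eq_add_of_le hN2
  have hdR : (N : ℝ) = k + r + d := by exact_mod_cast hd
  set L := (s ^ q * k - r) * β with hL
  have hLd : L ≤ d * β := by
    rw [hL]; gcongr; linarith
  set v : Fin p → ℝ := fun i => if i ∈ H2 then |h i| else 0 with hv
  have hvb : ∀ i, 0 ≤ v i ∧ v i ≤ β := by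
    intro i
    simp only [hv]
    split_ifs with hi
    · exact ⟨abs_nonneg _, not_lt.1 (Finset.mem_filter.1 hi).2⟩
    · exact ⟨le_rfl, hβ.le⟩
  have hvs : ∑ i, v i ≤ L := by
    have : ∑ i, v i = ∑ i ∈ H2, |h i| := by simp [hv]
    rw [this]
    calc ∑ i ∈ H2, |h i| ≤ ∑ i ∈ H2, β ^ (1 - q) * |h i| ^ q := by
          apply Finset.sum_le_sum; intro i hi
          have h1 : |h i| ≤ β := not_lt.1 (Finset.mem_filter.1 hi).2
          have h2 := Real.rpow_le_rpow (abs_nonneg _) h1 (by linarith : 0 ≤ 1 - q)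
          calc |h i| = |h i| ^ (1 - q) * |h i| ^ q := by
                rw [← Real.rpow_add' (abs_nonneg _) (by norm_num)]; simp
            _ ≤ _ := by gcongr
      _ ≤ β ^ (1 - q) * ((s ^ q * k - r) * β ^ q) := by
          rw [← Finset.mul_sum]; gcongr
      _ = L := by
          have : β ^ (1 - q) * β ^ q = β := by rw [← Real.rpow_add hβ]; simp
          rw [hL]; linear_combination (s ^ q * k - r) * this
  set a : Fin p → ℝ := fun i => if i ∈ T ∪ H1 then h i else 0 with ha
  set g : Fin p → ℝ := Matrix.vecMul (A.mulVec a) A with hg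
  have hgdot : ∀ w : Fin p → ℝ, ∑ i, A.mulVec a i * A.mulVec w i = ∑ i, g i * w i := by
    intro w
    exact Matrix.dotProduct_mulVec (A.mulVec a) A w
  set sg : Fin p → ℝ := fun i => if 0 ≤ h i then 1 else -1 with hsg
  have hsg2 : ∀ i, sg i ^ 2 = 1 := by intro i; simp only [hsg]; split_ifs <;> norm_num
  have hsgh : ∀ i, sg i * |h i| = h i := by
    intro i; simp only [hsg]; split_ifs with h1
    · rw [abs_of_nonneg h1, one_mul]
    · rw [abs_of_neg (not_le.1 h1)]; ring
  obtain ⟨u', hu1, hu2, hu3, hu4, hu5⟩ := aux_sparse_pt (fun i => g i * sg i) β L d hβ hLd _ v hvb hvs le_rfl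
  set u : Fin p → ℝ := fun i => sg i * u' i with hu
  have hdecomp : ∀ i, a i + sg i * v i = h i := by
    intro i
    simp only [ha, hv]
    by_cases i1 : i ∈ T
    · have : i ∉ H2 := fun hh => (Finset.mem_compl.1 (Finset.mem_filter.1 hh).1) i1
      simp [i1, this]
    · by_cases i2 : β < |h i|
      · have j1 : i ∈ H1 := Finset.mem_filter.2 ⟨Finset.mem_compl.2 i1, i2⟩
        have j2 : i ∉ H2 := fun hh => (Finset.mem_filter.1 hh).2 i2
        simp [j1, j2]
      · have j1 : i ∉ H1 := fun hh => i2 (Finset.mem_filter.1 hh).2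
        have j2 : i ∈ H2 := Finset.mem_filter.2 ⟨Finset.mem_compl.2 i1, i2⟩
        simp [i1, j1, j2, hsgh]
  have huz : ∀ i ∈ T ∪ H1, u' i = 0 := by
    intro i hi
    apply hu2
    have : i ∉ H2 := by
      intro hh
      rw [hH2, Finset.mem_filter] at hh
      rcases Finset.mem_union.1 hi with h1 | h1
      · exact (Finset.mem_compl.1 hh.1) h1
      · exact hh.2 (Finset.mem_filter.1 h1).2
    simp [hv, this]
  have hau : ∀ i, a i * u i = 0 := by
    intro i
    by_cases hi : i ∈ T ∪ H1
    · simp [hu, huz i hi]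
    · simp only [ha, if_neg hi, zero_mul]
  have haT : ∑ i ∈ T, h i ^ 2 ≤ ∑ i, a i ^ 2 := by
    calc ∑ i ∈ T, h i ^ 2 = ∑ i ∈ T, a i ^ 2 := by
          apply Finset.sum_congr rfl; intro i hi
          simp [ha, hi]
      _ ≤ _ := Finset.sum_le_sum_of_subset_of_nonneg (Finset.subset_univ _) fun i _ _ => sq_nonneg _
  have hθ : (0 : ℝ) < s ^ (q - 2) := by positivity
  have hw2 : Real.sqrt (s ^ (q - 2) + 1) ^ 2 = s ^ (q - 2) + 1 := Real.sq_sqrt (by linarith)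
  have hU : ∑ i, u i ^ 2 ≤ s ^ (q - 2) * ∑ i, a i ^ 2 := by
    calc ∑ i, u i ^ 2 ≤ ∑ i, β * u' i := by
          apply Finset.sum_le_sum; intro i _
          simp only [hu]
          rw [mul_pow, hsg2, one_mul, sq]
          exact mul_le_mul_of_nonneg_right (hu1 i).2 (hu1 i).1
      _ = β * ∑ i, u' i := by rw [Finset.mul_sum]
      _ ≤ β * L := by gcongr
      _ ≤ β * (s ^ q * k * β) := by
          rw [hL]; gcongr; simp
      _ = s ^ (q - 2) * (k * α ^ 2) := by
          rw [Real.rpow_sub hs, hβd, Real.rpow_two]; field_simp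
      _ ≤ _ := by gcongr; linarith
  have hrip : ∀ b c : ℝ, 
      (1 - δ) * (∑ i, ((b • a + c • u) i) ^ 2) ≤ (∑ i, (A.mulVec (b • a + c • u) i) ^ 2) ∧
      (∑ i, (A.mulVec (b • a + c • u) i) ^ 2) ≤ (1 + δ) * (∑ i, ((b • a + c • u) i) ^ 2) := by
    intro b c
    rw [hδdef]
    apply aux_ric
    apply aux_sparse_of _ ((T ∪ H1) ∪ Finset.univ.filter (fun i => u' i ≠ 0))
    · intro i hi
      rw [Finset.mem_union, not_or] at hi
      have h1 : u' i = 0 := by simpa using hi.2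
      simp only [Pi.add_apply, Pi.smul_apply, smul_eq_mul, ha, hu, if_neg hi.1, h1, mul_zero, add_zero]
    · have := Finset.card_union_le (T ∪ H1) (Finset.univ.filter (fun i => u' i ≠ 0))
      have := Finset.card_union_le T H1
      omega
  have hK : ∑ i, A.mulVec a i * A.mulVec u i + ∑ i, A.mulVec a i ^ 2 ≤
      ∑ i, A.mulVec a i * A.mulVec h i := by
    simp only [sq (A.mulVec a _)]
    rw [hgdot, hgdot, hgdot]
    have : ∑ i, g i * h i = ∑ i, g i * sg i * v i + ∑ i, g i * a i := by
      rw [← Finset.sum_add_distrib]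
      apply Finset.sum_congr rfl; intro i _
      rw [← hdecomp i]; ring
    rw [this]
    simp only [hu, ← mul_assoc]
    linarith
  have hfin := aux_alg A a u h δ (Real.sqrt (s ^ (q - 2) + 1)) hδ0 (Real.sqrt_pos.2 (by linarith)) hau
    hrip (by rw [hw2]; simpa using hU) hK
  have hha : l2Norm h ≤ Real.sqrt 2 * l2Norm a := by
    unfold l2Norm
    rw [← Real.sqrt_mul (by norm_num)]
    exact Real.sqrt_le_sqrt (by linarith)
  rw [Real.sqrt_mul (by norm_num)]
  calc _ ≤ (1 - Real.sqrt (s ^ (q - 2) + 1) * δ) * (Real.sqrt 2 * l2Norm a) := by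
        apply mul_le_mul_of_nonneg_left hha; linarith
    _ = Real.sqrt 2 * ((1 - Real.sqrt (s ^ (q - 2) + 1) * δ) * l2Norm a) := by ring
    _ ≤ Real.sqrt 2 * (Real.sqrt (1 + δ) * l2Norm (A.mulVec h)) := by gcongr
    _ = _ := by ring

end helpers

/-- **Theorem 2 (stable recovery under `ℓ₂`-bounded noise).** -/
theorem lq_stable_recovery_l2_noise {n p : ℕ} (q : ℝ) (hq0 : 0 < q) (hq1 : q < 1)
    (k : ℕ) (hk : 0 < k) (s : ℝ) (hs : 0 < s)
    (A : Matrix (Fin n) (Fin p) ℝ) (x xk xhat : Fin p → ℝ) (z : Fin n → ℝ)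
    (ε η : ℝ) (y : Fin n → ℝ)
    (hz : l2Norm z ≤ ε) (hy : y = A.mulVec x + z)
    (hxk : IsMaxK k x xk)
    (hη : ε + specNorm A * l2Norm (x - xk) ≤ η)
    (δ : ℝ) (hδdef : δ = ric A ⌈(s ^ q + 1) * (k : ℝ)⌉₊)
    (hδ : δ < 1 / Real.sqrt (s ^ (q - 2) + 1))
    (hfeas : l2Norm (y - A.mulVec xhat) ≤ η)
    (hmin : ∀ w : Fin p → ℝ, l2Norm (y - A.mulVec w) ≤ η → lqq q xhat ≤ lqq q w) :
    l2Norm (xhat - x) ≤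
      Real.sqrt (2 * (1 + δ)) * (ε + η) / (1 - Real.sqrt (s ^ (q - 2) + 1) * δ) +
      (Real.sqrt (2 * (1 + δ)) * specNorm A / (1 - Real.sqrt (s ^ (q - 2) + 1) * δ) + 1) *
        l2Norm (x - xk) := by
  obtain ⟨S, hSc, _, hxkd⟩ := hxk
  have hsq : 0 < Real.sqrt (s ^ (q - 2) + 1) := Real.sqrt_pos.2 (by positivity)
  have hD : Real.sqrt (s ^ (q - 2) + 1) * δ < 1 := by
    rw [lt_div_iff₀ hsq] at hδ; linarith
  have hxres : l2Norm (y - A.mulVec xk) ≤ ε + specNorm A * l2Norm (x - xk) := by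
    have : y - A.mulVec xk = z + A.mulVec (x - xk) := by
      rw [hy, Matrix.mulVec_sub]; abel
    rw [this]
    exact (aux_tri _ _).trans (add_le_add hz (aux_spec A _))
  have hle := hmin xk (hxres.trans hη)
  have hcone := aux_cone q hq0 hq1 xk xhat S (fun i hi => by rw [hxkd]; simp [hi]) hle
  set h := xhat - xk with hh
  obtain ⟨T, hTc, M, hM, hM1, hM2⟩ := aux_thresh (p := p) hk (fun i => |h i|) (fun i => abs_nonneg _)
  have hdom := aux_sum_dom (fun i => |h i| ^ q) S T (hSc.trans hTc.symm) (M ^ q)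
    (fun i hi => Real.rpow_le_rpow hM (hM1 i hi) hq0.le)
    (fun i hi => Real.rpow_le_rpow (abs_nonneg _) (hM2 i hi) hq0.le)
  rw [← Finset.sum_add_sum_compl T] at hcone
  have hc : ∑ i ∈ Tᶜ, |h i| ^ q ≤ ∑ i ∈ T, |h i| ^ q := by linarith
  have ht := aux_tail q hq0 hq1 h T M hM hM1 hM2 hc
  have hcore := aux_core q hq0 hq1 k hk s hs A h T (hTc.le.trans (min_le_left _ _)) hc ht δ hδdef hD
  have hAh : l2Norm (A.mulVec h) ≤ ε + η + specNorm A * l2Norm (x - xk) := by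
    have : A.mulVec h = (y - A.mulVec xk) + -(y - A.mulVec xhat) := by
      rw [hh, Matrix.mulVec_sub]; abel
    rw [this]
    have := aux_tri (y - A.mulVec xk) (-(y - A.mulVec xhat))
    rw [aux_neg] at this
    linarith
  have hpos : 0 < 1 - Real.sqrt (s ^ (q - 2) + 1) * δ := by linarith
  have h1 : l2Norm h ≤ Real.sqrt (2 * (1 + δ)) * (ε + η + specNorm A * l2Norm (x - xk)) /
      (1 - Real.sqrt (s ^ (q - 2) + 1) * δ) := by
    rw [le_div_iff₀ hpos, mul_comm]
    exact hcore.trans (mul_le_mul_of_nonneg_left hAh (Real.sqrt_nonneg _))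
  have h2 : l2Norm (xhat - x) ≤ l2Norm h + l2Norm (x - xk) := by
    have : xhat - x = h + -(x - xk) := by rw [hh]; abel
    rw [this]
    have := aux_tri h (-(x - xk))
    rwa [aux_neg] at this
  refine h2.trans ((add_le_add_left h1 _).trans (le_of_eq ?_))
  ring
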